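/- arXiv:1705.07728 — 2 statements merged into one kernel-verified Lean document; each statement's English description precedes it below -/
import Mathlib

section
/- For ℓ ≥ 2, and any pair (Ψ, Ψ') of elements of T_ℓ with matrix rank ℓ and ℓ−1 respectively, there exists (X,Y) ∈ GL_ℓ(K)×GL_ℓ(K) stabilizing T_ℓ setwise (under M·(X,Y) = XᵀMY) such that Ψ·(X,Y) = I and Ψ'·(X,Y) = N. -/
open Matrix

variable {K : Type*} [Field K]

/-- The nilpotent Jordan block: 1s on the superdiagonal, 0s elsewhere. -/
def jordanN (K : Type*) [Field K] (ℓ : ℕ) : Matrix (Fin ℓ) (Fin ℓ) K :=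
  Matrix.of fun i j => if (j : ℕ) = (i : ℕ) + 1 then 1 else 0

/-- The upper-triangular Toeplitz matrix with entries `m (j - i)` for `i ≤ j`. -/
def toepl {ℓ : ℕ} (m : Fin ℓ → K) : Matrix (Fin ℓ) (Fin ℓ) K :=
  Matrix.of fun i j =>
    if (i : ℕ) ≤ (j : ℕ) then
      m ⟨(j : ℕ) - (i : ℕ), lt_of_le_of_lt (Nat.sub_le _ _) j.isLt⟩
    else 0

theorem jordanN_pow (ℓ k : ℕ) (i j : Fin ℓ) :
    (jordanN K ℓ ^ k) i j = if (j : ℕ) = (i : ℕ) + k then 1 else 0 := by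
  induction k generalizing i j with
  | zero => simp [Matrix.one_apply, Fin.ext_iff, eq_comm]
  | succ k ih =>
    rw [pow_succ', Matrix.mul_apply]
    simp only [ih]
    by_cases h : (i : ℕ) + 1 < ℓ
    · rw [Finset.sum_eq_single ⟨i + 1, h⟩]
      · simp [jordanN, add_assoc, add_comm 1 k]
      · intro b _ hb
        have : (b : ℕ) ≠ i + 1 := fun h' => hb (Fin.ext h')
        simp [jordanN, this]
      · simp
    · rw [Finset.sum_eq_zero, if_neg (by have := j.2; omega)]
      intro b _
      have : (b : ℕ) ≠ i + 1 := by have := b.2; omega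
      simp [jordanN, this]

theorem toepl_eq_sum {ℓ : ℕ} (m : Fin ℓ → K) :
    toepl m = ∑ k : Fin ℓ, m k • jordanN K ℓ ^ (k : ℕ) := by
  ext i j
  rw [Matrix.sum_apply]
  simp only [Matrix.smul_apply, jordanN_pow, smul_eq_mul, toepl, Matrix.of_apply]
  split_ifs with h
  · rw [Finset.sum_eq_single ⟨(j : ℕ) - i, lt_of_le_of_lt (Nat.sub_le _ _) j.isLt⟩]
    · rw [if_pos (by simp; omega), mul_one]
    · intro b _ hb
      rw [if_neg, mul_zero]
      intro h'
      apply hb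
      ext
      simp; omega
    · simp
  · symm
    apply Finset.sum_eq_zero
    intro b _
    rw [if_neg (by omega), mul_zero]

theorem toepl_commute_of {ℓ : ℕ} (m : Fin ℓ → K) (B : Matrix (Fin ℓ) (Fin ℓ) K)
    (hB : Commute (jordanN K ℓ) B) : Commute (toepl m) B := by
  rw [toepl_eq_sum]
  exact Commute.sum_left _ _ _ fun k _ => (hB.pow_left _).smul_left _

theorem jordanN_mul_apply {ℓ : ℕ} (M : Matrix (Fin ℓ) (Fin ℓ) K) (i j : Fin ℓ)
    (h : (i : ℕ) + 1 < ℓ) : (jordanN K ℓ * M) i j = M ⟨i + 1, h⟩ j := by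
  rw [Matrix.mul_apply, Finset.sum_eq_single ⟨i + 1, h⟩]
  · simp [jordanN]
  · intro b _ hb
    have : (b : ℕ) ≠ i + 1 := fun h' => hb (Fin.ext h')
    simp [jordanN, this]
  · simp

theorem jordanN_mul_apply_last {ℓ : ℕ} (M : Matrix (Fin ℓ) (Fin ℓ) K) (i j : Fin ℓ)
    (h : ¬ (i : ℕ) + 1 < ℓ) : (jordanN K ℓ * M) i j = 0 := by
  rw [Matrix.mul_apply]
  apply Finset.sum_eq_zero
  intro b _
  have : (b : ℕ) ≠ i + 1 := by have := b.2; omega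
  simp [jordanN, this]

theorem mul_jordanN_apply {n : ℕ} (M : Matrix (Fin (n + 1)) (Fin (n + 1)) K) (i j : Fin (n + 1)) :
    (M * jordanN K (n + 1)) i j = if h : (j : ℕ) = 0 then 0 else M i ⟨j - 1, by omega⟩ := by
  rw [Matrix.mul_apply]
  split_ifs with h
  · apply Finset.sum_eq_zero
    intro b _
    simp [jordanN, h]
  · rw [Finset.sum_eq_single ⟨(j : ℕ) - 1, by omega⟩]
    · have : (j : ℕ) = j - 1 + 1 := by omega
      simp [jordanN, ← this]
    · intro b _ hb
      have : (j : ℕ) ≠ b + 1 := fun h' => hb (Fin.ext (by simp; omega))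
      simp [jordanN, this]
    · simp

theorem mem_range_toepl_iff {n : ℕ} (M : Matrix (Fin (n + 1)) (Fin (n + 1)) K) :
    M ∈ Set.range (toepl : (Fin (n + 1) → K) → Matrix (Fin (n + 1)) (Fin (n + 1)) K) ↔
      Commute (jordanN K (n + 1)) M := by
  constructor
  · rintro ⟨m, rfl⟩
    exact (toepl_commute_of m _ (Commute.refl _)).symm
  · intro h
    refine ⟨fun j => M 0 j, ?_⟩
    have key : ∀ (i : ℕ) (hi : i < n + 1) (j : Fin (n + 1)),
        toepl (fun j => M 0 j) ⟨i, hi⟩ j = M ⟨i, hi⟩ j := by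
      intro i
      induction i with
      | zero => intro hi j; simp [toepl]
      | succ i ih =>
        intro hi j
        have h1 := congrFun (congrFun h.eq ⟨i, by omega⟩) j
        rw [jordanN_mul_apply _ _ _ hi, mul_jordanN_apply] at h1
        simp only at h1
        rw [h1]
        split_ifs with hj
        · simp only [toepl, Matrix.of_apply]
          rw [if_neg (by omega)]
        · rw [← ih]
          simp only [toepl, Matrix.of_apply]
          by_cases hij : i + 1 ≤ (j : ℕ)
          · rw [if_pos hij, if_pos (by omega)]
            congr 2
            omega
          · rw [if_neg hij, if_neg (by omega)]
    ext i j
    exact key i i.2 j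

theorem pow_upper {ℓ : ℕ} (A : Matrix (Fin ℓ) (Fin ℓ) K) (a : K)
    (h0 : ∀ i j : Fin ℓ, (j : ℕ) < i + 1 → A i j = 0)
    (h1 : ∀ i j : Fin ℓ, (j : ℕ) = i + 1 → A i j = a) (k : ℕ) :
    (∀ i j : Fin ℓ, (j : ℕ) < i + k → (A ^ k) i j = 0) ∧
    (∀ i j : Fin ℓ, (j : ℕ) = i + k → (A ^ k) i j = a ^ k) := by
  induction k with
  | zero =>
    constructor
    · intro i j h
      simp [Matrix.one_apply, Fin.ext_iff]; omega
    · intro i j h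
      simp [Matrix.one_apply, Fin.ext_iff]; omega
  | succ k ih =>
    constructor
    · intro i j h
      rw [pow_succ, Matrix.mul_apply]
      apply Finset.sum_eq_zero
      intro b _
      by_cases hb : (b : ℕ) < i + k
      · rw [ih.1 _ _ hb, zero_mul]
      · rw [h0 _ _ (by omega), mul_zero]
    · intro i j h
      rw [pow_succ, Matrix.mul_apply, Finset.sum_eq_single ⟨i + k, by omega⟩]
      · rw [ih.2 _ _ rfl, h1 _ _ (by simp; omega), pow_succ]
      · intro b _ hb
        have hb : (b : ℕ) ≠ i + k := fun h' => hb (Fin.ext h')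
        by_cases hb : (b : ℕ) < i + k
        · rw [ih.1 _ _ hb, zero_mul]
        · rw [h0 _ _ (by omega), mul_zero]
      · simp

theorem exists_conj {n : ℕ} (A : Matrix (Fin (n + 1)) (Fin (n + 1)) K) (a : K) (ha : a ≠ 0)
    (h0 : ∀ i j : Fin (n + 1), (j : ℕ) < i + 1 → A i j = 0)
    (h1 : ∀ i j : Fin (n + 1), (j : ℕ) = i + 1 → A i j = a) :
    ∃ Q : Matrix (Fin (n + 1)) (Fin (n + 1)) K, IsUnit Q ∧ Q * A = jordanN K (n + 1) * Q := by
  refine ⟨Matrix.of fun i j => (A ^ (i : ℕ)) 0 j, ?_, ?_⟩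
  · rw [Matrix.isUnit_iff_isUnit_det, Matrix.det_of_isUpperTriangular]
    · rw [isUnit_iff_ne_zero, Finset.prod_ne_zero_iff]
      intro i _
      rw [Matrix.of_apply, (pow_upper A a h0 h1 i).2 _ _ (by simp)]
      exact pow_ne_zero _ ha
    · intro i j hij
      rw [Matrix.of_apply]
      apply (pow_upper A a h0 h1 i).1
      simpa using hij
  · ext i j
    have hL : ((Matrix.of fun i j => (A ^ (i : ℕ)) 0 j : Matrix (Fin (n + 1)) (Fin (n + 1)) K) * A) i j
        = (A ^ ((i : ℕ) + 1)) 0 j := by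
      rw [pow_succ, Matrix.mul_apply, Matrix.mul_apply]; rfl
    rw [hL]
    by_cases h : (i : ℕ) + 1 < n + 1
    · rw [jordanN_mul_apply _ _ _ h]; rfl
    · rw [jordanN_mul_apply_last _ _ _ h]
      apply (pow_upper A a h0 h1 _).1
      have := j.2
      simp; omega

theorem isUnit_of_rank {n : ℕ} (A : Matrix (Fin n) (Fin n) K) (h : A.rank = n) : IsUnit A := by
  rw [← Matrix.mulVec_surjective_iff_isUnit]
  have : LinearMap.range A.mulVecLin = ⊤ := by
    apply Submodule.eq_top_of_finrank_eq
    rw [← Matrix.rank, h]; simp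
  exact LinearMap.range_eq_top.1 this

theorem toepl_rank {n : ℕ} (m : Fin (n + 2) → K) (h : (toepl m).rank = n + 1) :
    m 0 = 0 ∧ m 1 ≠ 0 := by
  classical
  have h0 : m 0 = 0 := by
    by_contra h0
    have : IsUnit (toepl m) := by
      rw [Matrix.isUnit_iff_isUnit_det, Matrix.det_of_isUpperTriangular]
      · rw [isUnit_iff_ne_zero, Finset.prod_ne_zero_iff]
        intro i _
        simpa [toepl] using h0
      · intro i j hij
        have hij : j < i := hij
        simp [toepl, hij]
    have := Matrix.rank_of_isUnit _ this
    simp at this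
    omega
  refine ⟨h0, fun h1 => ?_⟩
  have hD : toepl m = toepl m * Matrix.diagonal (fun j : Fin (n + 2) => if (j : ℕ) < 2 then (0 : K) else 1) := by
    ext i j
    rw [Matrix.mul_diagonal]
    split_ifs with hj
    · simp only [toepl, Matrix.of_apply, mul_zero]
      split_ifs with hij
      · have : (j : ℕ) - i = 0 ∨ (j : ℕ) - i = 1 := by omega
        rcases this with h | h
        · simp only [h]; exact h0
        · simp only [h]; exact h1
      · rfl
    · simp
  have hle := Matrix.rank_mul_le_right (toepl m) (Matrix.diagonal (fun j : Fin (n + 2) => if (j : ℕ) < 2 then (0 : K) else 1))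
  rw [← hD, h, Matrix.rank_diagonal, Fintype.card_subtype] at hle
  have hsub : (Finset.univ.filter fun j : Fin (n + 2) => (if (j : ℕ) < 2 then (0 : K) else 1) ≠ 0) ⊆
      (Finset.univ.erase 0).erase 1 := by
    intro j hj
    simp at hj
    rw [Finset.mem_erase, Finset.mem_erase]
    refine ⟨?_, ?_, Finset.mem_univ _⟩
    · rintro rfl
      simp at hj
    · rintro rfl
      simp at hj
  have := Finset.card_le_card hsub
  rw [Finset.card_erase_of_mem (by simp), Finset.card_erase_of_mem (by simp)] at this
  simp at this
  simp at hle
  omega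

theorem image_eq {n : ℕ} (L R : Matrix (Fin n) (Fin n) K) (hL : IsUnit L) (hR : IsUnit R)
    (S : Submodule K (Matrix (Fin n) (Fin n) K)) (h : ∀ A ∈ S, L * A * R ∈ S) :
    (fun A => L * A * R) '' (S : Set (Matrix (Fin n) (Fin n) K)) = S := by
  let f : Matrix (Fin n) (Fin n) K →ₗ[K] Matrix (Fin n) (Fin n) K :=
    LinearMap.mulRight K R ∘ₗ LinearMap.mulLeft K L
  have hf : Function.Injective f := by
    intro A B hAB
    exact hL.mul_left_cancel (hR.mul_right_cancel hAB)
  have hle : S.map f ≤ S := by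
    rintro _ ⟨A, hA, rfl⟩
    exact h A hA
  have := Submodule.eq_of_le_of_finrank_eq hle (LinearEquiv.finrank_eq (Submodule.equivMapOfInjective f hf S)).symm
  exact congrArg (fun S : Submodule K _ => (S : Set (Matrix (Fin n) (Fin n) K))) this

theorem stmt13 (ℓ : ℕ) (hℓ : 2 ≤ ℓ) (Ψ Ψ' : Matrix (Fin ℓ) (Fin ℓ) K)
    (hΨ : Ψ ∈ Set.range (toepl : (Fin ℓ → K) → Matrix (Fin ℓ) (Fin ℓ) K))
    (hΨ' : Ψ' ∈ Set.range (toepl : (Fin ℓ → K) → Matrix (Fin ℓ) (Fin ℓ) K))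
    (hr : Ψ.rank = ℓ) (hr' : Ψ'.rank = ℓ - 1) :
    ∃ X Y : Matrix (Fin ℓ) (Fin ℓ) K, IsUnit X ∧ IsUnit Y ∧
      (fun A => Xᵀ * A * Y) '' Set.range (toepl : (Fin ℓ → K) → Matrix (Fin ℓ) (Fin ℓ) K)
        = Set.range (toepl : (Fin ℓ → K) → Matrix (Fin ℓ) (Fin ℓ) K) ∧
      Xᵀ * Ψ * Y = 1 ∧ Xᵀ * Ψ' * Y = jordanN K ℓ := by
  obtain ⟨n, rfl⟩ : ∃ n, ℓ = n + 2 := ⟨ℓ - 2, by omega⟩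
  obtain ⟨U, hUΨ⟩ := isUnit_of_rank Ψ hr
  obtain ⟨R, hR, hRu, hRΨ⟩ : ∃ R : Matrix (Fin (n + 2)) (Fin (n + 2)) K,
      Commute (jordanN K (n + 2)) R ∧ IsUnit R ∧ R * Ψ = 1 := by
    refine ⟨(U⁻¹).val, ?_, Units.isUnit _, ?_⟩
    · apply Commute.units_inv_right
      rw [hUΨ]
      exact (mem_range_toepl_iff _).1 hΨ
    · rw [← hUΨ, Units.inv_mul]
  have hA : Commute (jordanN K (n + 2)) (R * Ψ') := hR.mul_right ((mem_range_toepl_iff _).1 hΨ')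
  obtain ⟨m, hm⟩ := (mem_range_toepl_iff _).2 hA
  have hrk : (toepl m).rank = n + 1 := by
    rw [hm, Matrix.rank_mul_eq_right_of_isUnit_det _ _ ((Matrix.isUnit_iff_isUnit_det _).1 hRu), hr']
    rfl
  obtain ⟨h0, h1⟩ := toepl_rank m hrk
  obtain ⟨Q, hQ, hQA⟩ := exists_conj (toepl m) (m 1) h1
    (by
      intro i j hij
      simp only [toepl, Matrix.of_apply]
      split_ifs
      · have : (j : ℕ) - i = 0 := by omega
        simp only [this]; exact h0
      · rfl)
    (by
      intro i j hij
      have : (j : ℕ) - i = 1 := by omega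
      simp only [toepl, Matrix.of_apply, this]
      rw [if_pos (by omega)]; rfl)
  obtain ⟨W, hW, hQW, hWQ⟩ : ∃ W : Matrix (Fin (n + 2)) (Fin (n + 2)) K,
      IsUnit W ∧ Q * W = 1 ∧ W * Q = 1 := by
    obtain ⟨V, rfl⟩ := hQ
    exact ⟨(V⁻¹).val, Units.isUnit _, Units.mul_inv _, Units.inv_mul _⟩
  have hN : Q * toepl m * W = jordanN K (n + 2) := by
    rw [hQA, mul_assoc, hQW, mul_one]
  have hset : Set.range (toepl : (Fin (n + 2) → K) → Matrix (Fin (n + 2)) (Fin (n + 2)) K) =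
      (Subalgebra.toSubmodule (Subalgebra.centralizer K {jordanN K (n + 2)}) :
        Set (Matrix (Fin (n + 2)) (Fin (n + 2)) K)) := by
    ext M
    rw [mem_range_toepl_iff]
    simp [Set.mem_centralizer_iff, Commute, SemiconjBy]
  refine ⟨(Q * R)ᵀ, W, ?_, hW, ?_, ?_, ?_⟩
  · rw [Matrix.isUnit_transpose]; exact hQ.mul hRu
  · rw [Matrix.transpose_transpose, hset]
    apply image_eq _ _ (hQ.mul hRu) hW
    intro B hB
    rw [← SetLike.mem_coe, ← hset, mem_range_toepl_iff] at hB ⊢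
    have hc := (toepl_commute_of m _ (hR.mul_right hB)).eq
    rw [← hN]
    change _ = _
    generalize toepl m = T at hc
    calc Q * T * W * (Q * R * B * W)
        = Q * T * (W * Q) * R * B * W := by simp only [mul_assoc]
      _ = Q * (T * (R * B)) * W := by rw [hWQ]; simp only [mul_assoc, one_mul]
      _ = Q * (R * B) * (W * Q) * T * W := by
        rw [hc, hWQ]; simp only [mul_assoc, one_mul]
      _ = _ := by simp only [mul_assoc]
  · rw [Matrix.transpose_transpose, mul_assoc Q, hRΨ, mul_one, hQW]
  · rw [Matrix.transpose_transpose, ← hN, hm, mul_assoc Q R]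
end

section
/- Over K = 𝔽₂, the set ALG(1) of subspaces of Bil(1,1) spanned by a free family of one rank-one bilinear form, modulo the action of GL₁ × GL₁, has exactly one element; and ALG(2,2,2)/(GL₂(𝔽₂) × GL₂(𝔽₂)) has exactly 3 elements, represented by the pairs of column-echelon matrices ((1,1;·),(1,0;0,1)), ((1,0;0,1),(1,0;0,1)) and ((1,0;0,1),(1,1;·)) encoding the rank-one generators. -/
open scoped BigOperators

variable {K : Type*} [Field K]

/-- The space of bilinear forms on `K^m × K^n`. -/
abbrev Bil (m n : ℕ) (K : Type*) [Field K] :=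
  (Fin m → K) →ₗ[K] (Fin n → K) →ₗ[K] K

/-- A bilinear form has rank one if it is the product of two nonzero linear forms. -/
def IsRankOne {m n : ℕ} (φ : Bil m n K) : Prop :=
  ∃ (α : (Fin m → K) →ₗ[K] K) (β : (Fin n → K) →ₗ[K] K),
    α ≠ 0 ∧ β ≠ 0 ∧ ∀ a b, φ a b = α a * β b

/-- The action of a pair of invertible linear maps on bilinear forms:
`(actE μ ν φ) a b = φ (μ a) (ν b)`. -/
def actE {m n : ℕ} (μ : (Fin m → K) ≃ₗ[K] (Fin m → K))
    (ν : (Fin n → K) ≃ₗ[K] (Fin n → K)) : Bil m n K ≃ₗ[K] Bil m n K :=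
  (LinearEquiv.arrowCongr μ (LinearEquiv.arrowCongr ν (LinearEquiv.refl K K))).symm

/-- `V` is spanned by a linearly independent family of `r` rank-one bilinear forms. -/
def SpannedByRankOne {m n : ℕ} (V : Submodule K (Bil m n K)) (r : ℕ) : Prop :=
  ∃ φ : Fin r → Bil m n K, LinearIndependent K φ ∧ (∀ t, IsRankOne (φ t)) ∧
    Submodule.span K (Set.range φ) = V

/-- The linear form `a ↦ Σ α i * a i`. -/
def lform {m : ℕ} (α : Fin m → K) : (Fin m → K) →ₗ[K] K :=
  ∑ i, α i • LinearMap.proj i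

/-- The rank-one bilinear form `(a,b) ↦ (Σ α i * a i) * (Σ β j * b j)`. -/
def ro {m n : ℕ} (α : Fin m → K) (β : Fin n → K) : Bil m n K :=
  (lform α).smulRight (lform β)

/-- Two subspaces of bilinear forms are related if one is the image of the other
under the action of `GL_m × GL_n`. -/
def relSub (m n : ℕ) (V V' : Submodule K (Bil m n K)) : Prop :=
  ∃ (μ : (Fin m → K) ≃ₗ[K] (Fin m → K)) (ν : (Fin n → K) ≃ₗ[K] (Fin n → K)),
    Submodule.map (actE μ ν).toLinearMap V = V'


theorem ro_app {m n : ℕ} (α : Fin m → K) (β : Fin n → K) (a b) :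
    ro α β a b = (∑ i, α i * a i) * (∑ j, β j * b j) := by
  simp [ro, lform]

theorem actE_app {m n : ℕ} (μ : (Fin m → K) ≃ₗ[K] (Fin m → K))
    (ν : (Fin n → K) ≃ₗ[K] (Fin n → K)) (φ : Bil m n K) (a b) :
    actE μ ν φ a b = φ (μ a) (ν b) := by
  simp [actE, LinearEquiv.arrowCongr]

theorem lform_ne {m : ℕ} (α : Fin m → K) (h : α ≠ 0) : lform α ≠ 0 := by
  intro h0
  apply h
  funext i
  have := congrArg (fun f => f (Pi.single i 1)) h0
  simpa [lform, Pi.single_apply] using this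

theorem ro_rankOne {m n : ℕ} (α : Fin m → K) (β : Fin n → K) (h : α ≠ 0) (h' : β ≠ 0) :
    IsRankOne (ro α β) :=
  ⟨lform α, lform β, lform_ne α h, lform_ne β h', fun a b => by simp [ro]⟩

/-- Left kernel is nontrivial. -/
def LK (V : Submodule K (Bil 2 2 K)) : Prop := ∃ a, a ≠ 0 ∧ ∀ φ ∈ V, ∀ b, φ a b = 0
/-- Right kernel is nontrivial. -/
def RK (V : Submodule K (Bil 2 2 K)) : Prop := ∃ b, b ≠ 0 ∧ ∀ φ ∈ V, ∀ a, φ a b = 0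

theorem LK_rel (V V' : Submodule K (Bil 2 2 K)) (h : relSub 2 2 V V') : LK V ↔ LK V' := by
  obtain ⟨μ, ν, rfl⟩ := h
  constructor
  · rintro ⟨a, ha, h⟩
    refine ⟨μ.symm a, by simpa using ha, ?_⟩
    rintro _ ⟨φ, hφ, rfl⟩ b
    simp [actE_app, h φ hφ]
  · rintro ⟨a, ha, h⟩
    refine ⟨μ a, by simpa using ha, fun φ hφ b => ?_⟩
    have := h (actE μ ν φ) ⟨φ, hφ, rfl⟩ (ν.symm b)
    simpa [actE_app] using this

theorem RK_rel (V V' : Submodule K (Bil 2 2 K)) (h : relSub 2 2 V V') : RK V ↔ RK V' := by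
  obtain ⟨μ, ν, rfl⟩ := h
  constructor
  · rintro ⟨a, ha, h⟩
    refine ⟨ν.symm a, by simpa using ha, ?_⟩
    rintro _ ⟨φ, hφ, rfl⟩ b
    simp [actE_app, h φ hφ]
  · rintro ⟨a, ha, h⟩
    refine ⟨ν a, by simpa using ha, fun φ hφ b => ?_⟩
    have := h (actE μ ν φ) ⟨φ, hφ, rfl⟩ (μ.symm b)
    simpa [actE_app] using this

theorem span_pair_zero (x y : Bil 2 2 K) (a b) (hx : x a b = 0) (hy : y a b = 0) :
    ∀ φ ∈ Submodule.span K {x, y}, φ a b = 0 := by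
  intro φ hφ
  obtain ⟨s, t, rfl⟩ := Submodule.mem_span_pair.1 hφ
  simp [hx, hy]

theorem spanned_pair (x y : Bil 2 2 K) (hx : IsRankOne x) (hy : IsRankOne y)
    (a b c d) (h1 : x a b = 1) (h2 : y a b = 0) (h3 : x c d = 0) (h4 : y c d = 1) :
    SpannedByRankOne (Submodule.span K {x, y}) 2 := by
  refine ⟨![x, y], ?_, ?_, ?_⟩
  · refine LinearIndependent.pair_iff (R := K) (M := Bil 2 2 K) |>.2 ?_
    intro s t h
    have e1 := congrArg (fun f : Bil 2 2 K => f a b) h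
    have e2 := congrArg (fun f : Bil 2 2 K => f c d) h
    constructor
    · simpa [h1, h2] using e1
    · simpa [h3, h4] using e2
  · intro t
    fin_cases t
    · exact hx
    · exact hy
  · congr 1
    ext z
    simp [eq_comm, or_comm]

/-- The first representative. -/
abbrev W1 := Submodule.span (ZMod 2)
        {ro (K := ZMod 2) ![1, 0] ![1, 0], ro (K := ZMod 2) ![1, 0] ![0, 1]}
/-- The second representative. -/
abbrev W2 := Submodule.span (ZMod 2)
        {ro (K := ZMod 2) ![1, 0] ![1, 0], ro (K := ZMod 2) ![0, 1] ![0, 1]}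
/-- The third representative. -/
abbrev W3 := Submodule.span (ZMod 2)
        {ro (K := ZMod 2) ![1, 0] ![1, 0], ro (K := ZMod 2) ![0, 1] ![1, 0]}

theorem S1 : SpannedByRankOne W1 2 := by
  apply spanned_pair _ _ (ro_rankOne _ _ (by decide) (by decide))
    (ro_rankOne _ _ (by decide) (by decide)) ![1, 0] ![1, 0] ![1, 0] ![0, 1] <;> simp [ro_app]
theorem S2 : SpannedByRankOne W2 2 := by
  apply spanned_pair _ _ (ro_rankOne _ _ (by decide) (by decide))
    (ro_rankOne _ _ (by decide) (by decide)) ![1, 0] ![1, 0] ![0, 1] ![0, 1] <;> simp [ro_app]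
theorem S3 : SpannedByRankOne W3 2 := by
  apply spanned_pair _ _ (ro_rankOne _ _ (by decide) (by decide))
    (ro_rankOne _ _ (by decide) (by decide)) ![1, 0] ![1, 0] ![0, 1] ![1, 0] <;> simp [ro_app]

theorem mem1 (x y : Bil 2 2 K) : x ∈ Submodule.span K {x, y} := Submodule.subset_span (by simp)
theorem mem2 (x y : Bil 2 2 K) : y ∈ Submodule.span K {x, y} := Submodule.subset_span (by simp)

theorem L1 : LK W1 := by
  refine ⟨![0, 1], by decide, fun φ hφ b => span_pair_zero _ _ _ _ ?_ ?_ φ hφ⟩ <;> simp [ro_app]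
theorem R3 : RK W3 := by
  refine ⟨![0, 1], by decide, fun φ hφ b => span_pair_zero _ _ _ _ ?_ ?_ φ hφ⟩ <;> simp [ro_app]
theorem L2 : ¬ LK W2 := by
  rintro ⟨a, ha, h⟩
  apply ha
  have h1 := h _ (mem1 _ _) ![1, 0]
  have h2 := h _ (mem2 _ _) ![0, 1]
  simp [ro_app] at h1 h2
  funext i; fin_cases i <;> simpa
theorem L3 : ¬ LK W3 := by
  rintro ⟨a, ha, h⟩
  apply ha
  have h1 := h _ (mem1 _ _) ![1, 0]
  have h2 := h _ (mem2 _ _) ![1, 0]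
  simp [ro_app] at h1 h2
  funext i; fin_cases i <;> simpa
theorem R2 : ¬ RK W2 := by
  rintro ⟨a, ha, h⟩
  apply ha
  have h1 := h _ (mem1 _ _) ![1, 0]
  have h2 := h _ (mem2 _ _) ![0, 1]
  simp [ro_app] at h1 h2
  funext i; fin_cases i <;> simpa

theorem exists_equiv (α α' : (Fin 2 → ZMod 2) →ₗ[ZMod 2] ZMod 2) (h : α ≠ 0) (h' : α' ≠ 0)
    (hne : α ≠ α') : ∃ μ : (Fin 2 → ZMod 2) ≃ₗ[ZMod 2] (Fin 2 → ZMod 2),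
      (∀ a, α (μ a) = a 0) ∧ (∀ a, α' (μ a) = a 1) := by
  let f : (Fin 2 → ZMod 2) →ₗ[ZMod 2] (Fin 2 → ZMod 2) := LinearMap.pi ![α, α']
  have hexp : ∀ (γ : (Fin 2 → ZMod 2) →ₗ[ZMod 2] ZMod 2) a,
      γ a = a 0 * γ ![1, 0] + a 1 * γ ![0, 1] := by
    intro γ a
    have : a = a 0 • ![1, 0] + a 1 • ![0, 1] := by
      funext i; fin_cases i <;> simp
    conv_lhs => rw [this]
    simp only [map_add, map_smul, smul_eq_mul]
  have key : ∀ p q r s : ZMod 2, ¬ (p = 0 ∧ q = 0) → ¬ (r = 0 ∧ s = 0) → ¬ (p = r ∧ q = s) →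
      ∀ x y : ZMod 2, x * p + y * q = 0 → x * r + y * s = 0 → x = 0 ∧ y = 0 := by decide
  have hinj : Function.Injective f := by
    rw [injective_iff_map_eq_zero]
    intro a ha
    have e0 : α a = 0 := congrFun ha 0
    have e1 : α' a = 0 := congrFun ha 1
    rw [hexp] at e0 e1
    have := key _ _ _ _ ?_ ?_ ?_ _ _ e0 e1
    · funext i; fin_cases i
      · exact this.1
      · exact this.2
    · rintro ⟨x, y⟩; apply h; apply LinearMap.ext; intro t; rw [hexp α, x, y]; simp
    · rintro ⟨x, y⟩; apply h'; apply LinearMap.ext; intro t; rw [hexp α', x, y]; simp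
    · rintro ⟨x, y⟩; apply hne; apply LinearMap.ext; intro t; rw [hexp α, hexp α', x, y]
  let e := LinearEquiv.ofInjectiveEndo f hinj
  have he : ∀ a, f (e.symm a) = a := fun a => e.apply_symm_apply a
  exact ⟨e.symm, fun a => congrFun (he a) 0, fun a => congrFun (he a) 1⟩

theorem exists_equiv1 (α : (Fin 2 → ZMod 2) →ₗ[ZMod 2] ZMod 2) (h : α ≠ 0) :
    ∃ μ : (Fin 2 → ZMod 2) ≃ₗ[ZMod 2] (Fin 2 → ZMod 2), (∀ a, α (μ a) = a 0) := by
  have a1 : lform (K := ZMod 2) ![1, 0] ≠ 0 := lform_ne _ (by decide)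
  have a2 : lform (K := ZMod 2) ![0, 1] ≠ 0 := lform_ne _ (by decide)
  have a3 : lform (K := ZMod 2) ![0, 1] ≠ lform (K := ZMod 2) ![1, 0] := by
    intro h
    have := congrArg (fun f => f ![1, 0]) h
    simp [lform] at this
  by_cases hc : α = lform ![1, 0]
  · obtain ⟨μ, h1, _⟩ := exists_equiv α _ h a2 (by rw [hc]; exact a3.symm)
    exact ⟨μ, h1⟩
  · obtain ⟨μ, h1, _⟩ := exists_equiv α _ h a1 hc
    exact ⟨μ, h1⟩

theorem rel_of (φ : Fin 2 → Bil 2 2 K) (x y : Bil 2 2 K)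
    (μ ν : (Fin 2 → K) ≃ₗ[K] (Fin 2 → K)) (h0 : actE μ ν (φ 0) = x) (h1 : actE μ ν (φ 1) = y) :
    relSub 2 2 (Submodule.span K (Set.range φ)) (Submodule.span K {x, y}) := by
  refine ⟨μ, ν, ?_⟩
  rw [Submodule.map_span]
  congr 1
  ext z
  simp [← h0, ← h1, Fin.exists_fin_two, eq_comm]

theorem classify (V : Submodule (ZMod 2) (Bil 2 2 (ZMod 2))) (hV : SpannedByRankOne V 2) :
    relSub 2 2 V W1 ∨ relSub 2 2 V W2 ∨ relSub 2 2 V W3 := by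
  obtain ⟨φ, hli, hro, rfl⟩ := hV
  obtain ⟨α, β, hα, hβ, h0⟩ := hro 0
  obtain ⟨α', β', hα', hβ', h1⟩ := hro 1
  have hne : φ 0 ≠ φ 1 := fun h => by simpa using hli.injective h
  by_cases ha : α = α'
  · by_cases hb : β = β'
    · exact absurd (LinearMap.ext fun a => LinearMap.ext fun b => by rw [h0, h1, ha, hb]) hne
    · left
      subst ha
      obtain ⟨μ, m0⟩ := exists_equiv1 α hα
      obtain ⟨ν, n0, n1⟩ := exists_equiv β β' hβ hβ' hb
      apply rel_of φ _ _ μ ν <;> refine LinearMap.ext fun a => LinearMap.ext fun b => ?_ <;>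
        rw [actE_app] <;> simp [h0, h1, m0, n0, n1, ro_app]
  · obtain ⟨μ, m0, m1⟩ := exists_equiv α α' hα hα' ha
    right
    by_cases hb : β = β'
    · right
      subst hb
      obtain ⟨ν, n0⟩ := exists_equiv1 β hβ
      apply rel_of φ _ _ μ ν <;> refine LinearMap.ext fun a => LinearMap.ext fun b => ?_ <;>
        rw [actE_app] <;> simp [h0, h1, m0, m1, n0, ro_app]
    · left
      obtain ⟨ν, n0, n1⟩ := exists_equiv β β' hβ hβ' hb
      apply rel_of φ _ _ μ ν <;> refine LinearMap.ext fun a => LinearMap.ext fun b => ?_ <;>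
        rw [actE_app] <;> simp [h0, h1, m0, m1, n0, n1, ro_app]

theorem card_one : Nat.card (Quot (fun V V' :
        {V : Submodule (ZMod 2) (Bil 1 1 (ZMod 2)) // SpannedByRankOne V 1} =>
        relSub 1 1 V.1 V'.1)) = 1 := by
  have htop : ∀ V : Submodule (ZMod 2) (Bil 1 1 (ZMod 2)), SpannedByRankOne V 1 → V = ⊤ := by
    rintro V ⟨φ, hli, -, rfl⟩
    refine Submodule.eq_top_of_finrank_eq (K := ZMod 2) (V := Bil 1 1 (ZMod 2)) ?_
    refine (finrank_span_eq_card (R := ZMod 2) (M := Bil 1 1 (ZMod 2)) hli).trans ?_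
    simp [Module.finrank_linearMap]
  have hs : Subsingleton {V : Submodule (ZMod 2) (Bil 1 1 (ZMod 2)) // SpannedByRankOne V 1} :=
    ⟨fun a b => Subtype.ext ((htop _ a.2).trans (htop _ b.2).symm)⟩
  rw [Nat.card_eq_one_iff_unique]
  refine ⟨⟨?_⟩, ⟨Quot.mk _ ⟨_, ⟨fun _ => ro ![1] ![1], ?_, ?_, rfl⟩⟩⟩⟩
  · rintro ⟨a⟩ ⟨b⟩
    rw [Subsingleton.elim a b]
  · refine (linearIndependent_unique_iff (R := ZMod 2) (M := Bil 1 1 (ZMod 2))).2 ?_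
    intro h
    have := congrArg (fun f : Bil 1 1 (ZMod 2) => f ![1] ![1]) h
    simp [ro_app] at this
  · intro t
    exact ro_rankOne _ _ (by decide) (by decide)

theorem card_three : Nat.card (Quot (fun V V' :
        {V : Submodule (ZMod 2) (Bil 2 2 (ZMod 2)) // SpannedByRankOne V 2} =>
        relSub 2 2 V.1 V'.1)) = 3 := by
  set r := (fun V V' :
        {V : Submodule (ZMod 2) (Bil 2 2 (ZMod 2)) // SpannedByRankOne V 2} =>
        relSub 2 2 V.1 V'.1) with hr
  let g : Quot r → Prop × Prop := Quot.lift (fun V => (LK V.1, RK V.1)) (fun V V' h =>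
    Prod.ext (propext (LK_rel _ _ h)) (propext (RK_rel _ _ h)))
  let q1 : Quot r := Quot.mk r ⟨W1, S1⟩
  let q2 : Quot r := Quot.mk r ⟨W2, S2⟩
  let q3 : Quot r := Quot.mk r ⟨W3, S3⟩
  have n12 : q1 ≠ q2 := fun h => L2 ((congrArg (fun q => (g q).1) h).mp L1)
  have n13 : q1 ≠ q3 := fun h => L3 ((congrArg (fun q => (g q).1) h).mp L1)
  have n23 : q2 ≠ q3 := fun h => R2 ((congrArg (fun q => (g q).2) h).mpr R3)
  have hb : Function.Bijective (![q1, q2, q3] : Fin 3 → Quot r) := by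
    constructor
    · intro i j h
      fin_cases i <;> fin_cases j <;> simp_all [n12.symm, n13.symm, n23.symm]
    · rintro ⟨V⟩
      rcases classify V.1 V.2 with h | h | h
      · exact ⟨0, (Quot.sound (r := r) (a := V) (b := ⟨W1, S1⟩) h).symm⟩
      · exact ⟨1, (Quot.sound (r := r) (a := V) (b := ⟨W2, S2⟩) h).symm⟩
      · exact ⟨2, (Quot.sound (r := r) (a := V) (b := ⟨W3, S3⟩) h).symm⟩
  rw [← Nat.card_eq_of_bijective _ hb]
  simp

theorem stmt19 :
    Nat.card (Quot (fun V V' :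
        {V : Submodule (ZMod 2) (Bil 1 1 (ZMod 2)) // SpannedByRankOne V 1} =>
        relSub 1 1 V.1 V'.1)) = 1 ∧
    Nat.card (Quot (fun V V' :
        {V : Submodule (ZMod 2) (Bil 2 2 (ZMod 2)) // SpannedByRankOne V 2} =>
        relSub 2 2 V.1 V'.1)) = 3 ∧
    SpannedByRankOne (Submodule.span (ZMod 2)
      {ro (K := ZMod 2) ![1, 0] ![1, 0], ro (K := ZMod 2) ![1, 0] ![0, 1]}) 2 ∧
    SpannedByRankOne (Submodule.span (ZMod 2)
      {ro (K := ZMod 2) ![1, 0] ![1, 0], ro (K := ZMod 2) ![0, 1] ![0, 1]}) 2 ∧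
    SpannedByRankOne (Submodule.span (ZMod 2)
      {ro (K := ZMod 2) ![1, 0] ![1, 0], ro (K := ZMod 2) ![0, 1] ![1, 0]}) 2 ∧
    ¬ relSub 2 2 (Submodule.span (ZMod 2)
        {ro (K := ZMod 2) ![1, 0] ![1, 0], ro (K := ZMod 2) ![1, 0] ![0, 1]})
      (Submodule.span (ZMod 2)
        {ro (K := ZMod 2) ![1, 0] ![1, 0], ro (K := ZMod 2) ![0, 1] ![0, 1]}) ∧
    ¬ relSub 2 2 (Submodule.span (ZMod 2)
        {ro (K := ZMod 2) ![1, 0] ![1, 0], ro (K := ZMod 2) ![1, 0] ![0, 1]})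
      (Submodule.span (ZMod 2)
        {ro (K := ZMod 2) ![1, 0] ![1, 0], ro (K := ZMod 2) ![0, 1] ![1, 0]}) ∧
    ¬ relSub 2 2 (Submodule.span (ZMod 2)
        {ro (K := ZMod 2) ![1, 0] ![1, 0], ro (K := ZMod 2) ![0, 1] ![0, 1]})
      (Submodule.span (ZMod 2)
        {ro (K := ZMod 2) ![1, 0] ![1, 0], ro (K := ZMod 2) ![0, 1] ![1, 0]}) ∧
    ∀ V : Submodule (ZMod 2) (Bil 2 2 (ZMod 2)), SpannedByRankOne V 2 →
      relSub 2 2 V (Submodule.span (ZMod 2)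
        {ro (K := ZMod 2) ![1, 0] ![1, 0], ro (K := ZMod 2) ![1, 0] ![0, 1]}) ∨
      relSub 2 2 V (Submodule.span (ZMod 2)
        {ro (K := ZMod 2) ![1, 0] ![1, 0], ro (K := ZMod 2) ![0, 1] ![0, 1]}) ∨
      relSub 2 2 V (Submodule.span (ZMod 2)
        {ro (K := ZMod 2) ![1, 0] ![1, 0], ro (K := ZMod 2) ![0, 1] ![1, 0]}) := by
  exact ⟨card_one, card_three, S1, S2, S3,
    fun h => L2 ((LK_rel _ _ h).1 L1), fun h => L3 ((LK_rel _ _ h).1 L1),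
    fun h => R2 ((RK_rel _ _ h).2 R3), classify⟩
end
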